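/- arXiv:2103.12046 — 3 statements merged into one kernel-verified Lean document; each statement's English description precedes it below -/
import Mathlib

section
/- Let U, Q ∈ ℝ^{n×p} satisfy UᵀU = I_p, QᵀQ = I_p and UᵀQ = 0. Let X, Y, M, N ∈ ℝ^{p×p}, set W := U·X + Q·Y and V := U·M + Q·N, and define sym(Z) := (Z + Zᵀ)/2. Then the tangent-space projection of W at V satisfies W − V·sym(Vᵀ·W) = U·( X − M·sym(Mᵀ·X + Nᵀ·Y) ) + Q·( Y − N·sym(Mᵀ·X + Nᵀ·Y) ). In particular, the projection of any matrix of the form U·X + Q·Y onto the Stiefel tangent space at any point U·M + Q·N again lies in the matrix space { U·X' + Q·Y' : X', Y' ∈ ℝ^{p×p} }. -/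
open Matrix

/-- The core identity in the proof of Proposition 3.4: projecting a matrix
`W = U·X + Q·Y` onto the Stiefel tangent space at `V = U·M + Q·N` stays in the
matrix space spanned by `U` and `Q`:
`W − V·sym(VᵀW) = U·(X − M·sym(MᵀX + NᵀY)) + Q·(Y − N·sym(MᵀX + NᵀY))`,
where `sym(Z) = (Z + Zᵀ)/2`. -/
theorem stiefel_projection_stays_in_span
    {n p : Type*} [Fintype n] [Fintype p] [DecidableEq p]
    (U Q : Matrix n p ℝ) (X Y M N : Matrix p p ℝ)
    (hU : Uᵀ * U = 1) (hQ : Qᵀ * Q = 1) (hUQ : Uᵀ * Q = 0) :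
    (U * X + Q * Y) -
        (U * M + Q * N) *
          ((1 / 2 : ℝ) •
            (((U * M + Q * N)ᵀ * (U * X + Q * Y)) +
              ((U * M + Q * N)ᵀ * (U * X + Q * Y))ᵀ)) =
      U * (X - M * ((1 / 2 : ℝ) • ((Mᵀ * X + Nᵀ * Y) + (Mᵀ * X + Nᵀ * Y)ᵀ))) +
        Q * (Y - N * ((1 / 2 : ℝ) • ((Mᵀ * X + Nᵀ * Y) + (Mᵀ * X + Nᵀ * Y)ᵀ))) := by
  have hQU : Qᵀ * U = 0 := by
    simpa using congrArg transpose hUQ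
  have hVW : (U * M + Q * N)ᵀ * (U * X + Q * Y) = Mᵀ * X + Nᵀ * Y := by
    have hU' (Z : Matrix p p ℝ) : Uᵀ * (U * Z) = Z := by
      rw [← Matrix.mul_assoc, hU, Matrix.one_mul]
    have hQ' (Z : Matrix p p ℝ) : Qᵀ * (Q * Z) = Z := by
      rw [← Matrix.mul_assoc, hQ, Matrix.one_mul]
    have hUQ' (Z : Matrix p p ℝ) : Uᵀ * (Q * Z) = 0 := by
      rw [← Matrix.mul_assoc, hUQ, Matrix.zero_mul]
    have hQU' (Z : Matrix p p ℝ) : Qᵀ * (U * Z) = 0 := by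
      rw [← Matrix.mul_assoc, hQU, Matrix.zero_mul]
    simp only [transpose_add, transpose_mul, Matrix.add_mul, Matrix.mul_add, Matrix.mul_assoc,
      hU', hQ', hUQ', hQU', Matrix.mul_zero, add_zero, zero_add]
  rw [hVW, Matrix.add_mul, Matrix.mul_sub, Matrix.mul_sub, Matrix.mul_assoc, Matrix.mul_assoc]
  abel
end

section
/- Let B ∈ ℝ^{p×p} with spectral norm ‖B‖₂ < √6, set S := (1/12)·B·Bᵀ − (1/2)·I_p, and let C ∈ ℝ^{p×p} be skew-symmetric (Cᵀ = −C). Then the unique solution Γ ∈ ℝ^{p×p} of the Sylvester equation S·Γ + Γ·S = C is skew-symmetric (Γᵀ = −Γ). -/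
open Matrix

theorem eq_zero_of_mul_add_mul_eq_smul {A : Type*} [NormedRing A] [NormedAlgebra ℝ A]
    {a x : A} {c : ℝ} (ha : 2 * ‖a‖ < c) (h : a * x + x * a = c • x) : x = 0 := by
  by_contra hx
  have hx_pos : 0 < ‖x‖ := norm_pos_iff.mpr hx
  have hc : 0 ≤ c := by linarith [norm_nonneg a]
  have h_norm : c * ‖x‖ ≤ 2 * ‖a‖ * ‖x‖ :=
    calc c * ‖x‖ = ‖a * x + x * a‖ := by rw [h, norm_smul, Real.norm_of_nonneg hc]
      _ ≤ ‖a * x‖ + ‖x * a‖ := norm_add_le _ _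
      _ ≤ ‖a‖ * ‖x‖ + ‖x‖ * ‖a‖ := add_le_add (norm_mul_le _ _) (norm_mul_le _ _)
      _ = 2 * ‖a‖ * ‖x‖ := by ring
  exact absurd (le_of_mul_le_mul_right h_norm hx_pos) (not_le.mpr ha)

/-- Skew-symmetry of the Sylvester update in the Sylvester-enhanced algebraic
Stiefel log algorithm (Algorithm 4, Section 3.3): if `‖B‖₂ < √6` (spectral
norm), `S = (1/12)·BBᵀ − (1/2)·I`, `C` is skew-symmetric and `Γ` solves the
Sylvester equation `S·Γ + Γ·S = C`, then `Γ` is skew-symmetric. -/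
theorem sylvester_solution_skew_symmetric
    {p : Type*} [Fintype p] [DecidableEq p]
    (B C Γ : Matrix p p ℝ)
    (hB : ‖Matrix.toEuclideanCLM (𝕜 := ℝ) B‖ < Real.sqrt 6)
    (hC : Cᵀ = -C)
    (hΓ : ((1 / 12 : ℝ) • (B * Bᵀ) - (1 / 2 : ℝ) • (1 : Matrix p p ℝ)) * Γ +
        Γ * ((1 / 12 : ℝ) • (B * Bᵀ) - (1 / 2 : ℝ) • (1 : Matrix p p ℝ)) = C) :
    Γᵀ = -Γ := by
  have h_norm : 2 * ‖Matrix.toEuclideanCLM (𝕜 := ℝ) (B * Bᵀ)‖ < 12 := by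
    rw [← conjTranspose_eq_transpose_of_trivial, ← star_eq_conjTranspose, map_mul, map_star]
    have h_cstar := CStarRing.norm_self_mul_star (x := Matrix.toEuclideanCLM (𝕜 := ℝ) B)
    rw [h_cstar]
    nlinarith [Real.sq_sqrt (show (0 : ℝ) ≤ 6 by norm_num),
      norm_nonneg (Matrix.toEuclideanCLM (𝕜 := ℝ) B)]
  have h_transpose := congrArg transpose hΓ
  simp only [transpose_add, transpose_mul, transpose_sub, transpose_smul, transpose_transpose,
    transpose_one, hC] at h_transpose
  have h_sum : B * Bᵀ * (Γᵀ + Γ) + (Γᵀ + Γ) * (B * Bᵀ) = (12 : ℝ) • (Γᵀ + Γ) := by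
    have h := congrArg ((12 : ℝ) • ·) (congrArg₂ (· + ·) hΓ h_transpose)
    simp only [sub_mul, mul_sub, smul_mul_assoc, mul_smul_comm, one_mul, mul_one, mul_add,
      add_mul, add_neg_cancel, smul_zero] at h ⊢
    rw [← sub_eq_zero, ← h]
    module
  refine eq_neg_of_add_eq_zero_left
    ((EmbeddingLike.map_eq_zero_iff (f := Matrix.toEuclideanCLM (n := p) (𝕜 := ℝ))).mp
      (eq_zero_of_mul_add_mul_eq_smul h_norm ?_))
  rw [← map_mul, ← map_mul, ← map_add, h_sum, map_smul]
end

section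
/- Let 0 < δ < 1, let B ∈ ℝ^{p×p} with spectral norm ‖B‖₂ ≤ δ, and set S := (1/12)·B·Bᵀ − (1/2)·I_p. If Γ, C ∈ ℝ^{p×p} satisfy the Sylvester equation S·Γ + Γ·S = C, then ‖Γ‖₂ ≤ (6/(6 − δ²))·‖C‖₂. -/
open Matrix

/-- In a real C⋆-ring, if `‖b‖ ≤ δ` with `δ ^ 2 < 6`, then a solution `x` of the Sylvester equation
with coefficient `(1 / 12) • (b * star b) - (1 / 2) • 1` is bounded by its right-hand side. -/
theorem norm_le_of_sylvester_eq {A : Type*} [NormedRing A] [StarRing A] [CStarRing A]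
    [NormedAlgebra ℝ A] {δ : ℝ} (hδ : δ ^ 2 < 6) {b x c : A} (hb : ‖b‖ ≤ δ)
    (h : ((1 / 12 : ℝ) • (b * star b) - (1 / 2 : ℝ) • (1 : A)) * x +
        x * ((1 / 12 : ℝ) • (b * star b) - (1 / 2 : ℝ) • (1 : A)) = c) :
    ‖x‖ ≤ (6 / (6 - δ ^ 2)) * ‖c‖ := by
  set s : A := b * star b with hs
  have hn : ‖s‖ ≤ δ ^ 2 := by
    rw [hs, CStarRing.norm_self_mul_star, ← sq]
    gcongr
  have hx : x = (1 / 12 : ℝ) • (s * x + x * s) - c := by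
    rw [← h]
    simp only [sub_mul, mul_sub, smul_mul_assoc, mul_smul_comm, one_mul, mul_one]
    module
  have hsum : ‖s * x + x * s‖ ≤ 2 * δ ^ 2 * ‖x‖ :=
    calc ‖s * x + x * s‖ ≤ ‖s‖ * ‖x‖ + ‖x‖ * ‖s‖ :=
          norm_add_le_of_le (norm_mul_le _ _) (norm_mul_le _ _)
      _ = 2 * ‖s‖ * ‖x‖ := by ring
      _ ≤ 2 * δ ^ 2 * ‖x‖ := by gcongr
  have hle : ‖x‖ ≤ (1 / 12 : ℝ) * ‖s * x + x * s‖ + ‖c‖ := by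
    conv_lhs => rw [hx]
    refine (norm_sub_le _ _).trans_eq ?_
    rw [norm_smul, Real.norm_of_nonneg (by norm_num)]
  rw [div_mul_eq_mul_div, le_div_iff₀ (by linarith)]
  linarith

/-- Norm bound for the solution of the symmetric Sylvester equation (proof of
Proposition 3.5): if `‖B‖₂ ≤ δ` with `0 < δ < 1`, `S = (1/12)·BBᵀ − (1/2)·I`
and `S·Γ + Γ·S = C`, then `‖Γ‖₂ ≤ (6/(6 − δ²))·‖C‖₂` (spectral norms). -/
theorem sylvester_solution_norm_bound
    {p : Type*} [Fintype p] [DecidableEq p]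
    (δ : ℝ) (hδ0 : 0 < δ) (hδ1 : δ < 1)
    (B Γ C : Matrix p p ℝ)
    (hB : ‖Matrix.toEuclideanCLM (𝕜 := ℝ) B‖ ≤ δ)
    (hΓ : ((1 / 12 : ℝ) • (B * Bᵀ) - (1 / 2 : ℝ) • (1 : Matrix p p ℝ)) * Γ +
        Γ * ((1 / 12 : ℝ) • (B * Bᵀ) - (1 / 2 : ℝ) • (1 : Matrix p p ℝ)) = C) :
    ‖Matrix.toEuclideanCLM (𝕜 := ℝ) Γ‖ ≤
      (6 / (6 - δ ^ 2)) * ‖Matrix.toEuclideanCLM (𝕜 := ℝ) C‖ := by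
  refine norm_le_of_sylvester_eq (b := Matrix.toEuclideanCLM (𝕜 := ℝ) B) (by nlinarith) hB ?_
  rw [← hΓ, ← map_star, Matrix.star_eq_conjTranspose, Matrix.conjTranspose_eq_transpose_of_trivial]
  simp only [map_add, map_sub, map_mul, map_smul, map_one]
end
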